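/- arXiv:1505.07305 — 4 statements merged into one kernel-verified Lean document; each statement's English description precedes it below -/
import Mathlib

section
/- For every integer n ≥ 1, the finite sum Σ_{k=0}^{n−1} F_{k−1}·𝔽_k equals F_n·𝔽_n − n, where F_{−1} = 1. -/
open Finset

/-- Harmonic Fibonacci numbers: 𝔽ₙ = ∑_{k=1}^{n} 1/F_k (with 𝔽₀ = 0). -/
noncomputable def harmonicFib (n : ℕ) : ℝ := ∑ k ∈ Finset.range n, 1 / (Nat.fib (k + 1) : ℝ)

/-- `fibPred k` is the Fibonacci number F_{k-1}, with the convention F_{-1} = 1. -/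
noncomputable def fibPred (k : ℕ) : ℝ := if k = 0 then 1 else (Nat.fib (k - 1) : ℝ)

theorem fibPred_add_fib (n : ℕ) : fibPred n + (Nat.fib n : ℝ) = Nat.fib (n + 1) := by
  cases n with
  | zero => simp [fibPred]
  | succ m => simp [fibPred, Nat.fib_add_two]

theorem harmonicFib_succ (n : ℕ) :
    harmonicFib (n + 1) = harmonicFib n + 1 / (Nat.fib (n + 1) : ℝ) :=
  Finset.sum_range_succ _ n

theorem sum_fibPred_mul_harmonicFib (n : ℕ) (hn : 1 ≤ n) :
    ∑ k ∈ Finset.range n, fibPred k * harmonicFib k =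
      (Nat.fib n : ℝ) * harmonicFib n - n := by
  clear hn
  induction n with
  | zero => simp
  | succ n ih =>
    have hpos : (Nat.fib (n + 1) : ℝ) ≠ 0 := by
      exact_mod_cast (Nat.fib_pos.2 n.succ_pos).ne'
    rw [Finset.sum_range_succ, ih, harmonicFib_succ, mul_add, mul_one_div_cancel hpos,
      ← fibPred_add_fib]
    push_cast
    ring
end

section
/- For every integer n ≥ 1, √(Σ_{k=0}^{n−1} F_{k−1}²·𝔽_k²) ≤ F_n·𝔽_n − n ≤ √(n·Σ_{k=0}^{n−1} F_{k−1}²·𝔽_k²), where F_{−1} = 1. -/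
open Finset

theorem harmonicFib_nonneg (n : ℕ) : 0 ≤ harmonicFib n :=
  Finset.sum_nonneg fun _ _ => by positivity

theorem fibPred_nonneg (n : ℕ) : 0 ≤ fibPred n := by
  unfold fibPred
  split_ifs <;> positivity

theorem fib_succ_eq_fib_add_fibPred (n : ℕ) :
    (Nat.fib (n + 1) : ℝ) = Nat.fib n + fibPred n := by
  cases n with
  | zero => simp [fibPred]
  | succ m => simp [fibPred, Nat.fib_add_two, add_comm (Nat.fib m : ℝ)]

theorem fib_mul_harmonicFib_sub (n : ℕ) :
    (Nat.fib n : ℝ) * harmonicFib n - n = ∑ k ∈ Finset.range n, fibPred k * harmonicFib k := by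
  induction n with
  | zero => simp
  | succ n ih =>
    have h : (Nat.fib (n + 1) : ℝ) ≠ 0 := by
      exact_mod_cast (Nat.fib_pos.mpr n.succ_pos).ne'
    rw [Finset.sum_range_succ, ← ih, harmonicFib_succ, mul_add, mul_one_div_cancel h,
      fib_succ_eq_fib_add_fibPred]
    push_cast
    ring

theorem sqrt_sum_sq_le_and_le (n : ℕ) (hn : 1 ≤ n) :
    Real.sqrt (∑ k ∈ Finset.range n, fibPred k ^ 2 * harmonicFib k ^ 2) ≤
        (Nat.fib n : ℝ) * harmonicFib n - n ∧
      (Nat.fib n : ℝ) * harmonicFib n - n ≤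
        Real.sqrt (n * ∑ k ∈ Finset.range n, fibPred k ^ 2 * harmonicFib k ^ 2) := by
  have hnonneg (k : ℕ) : 0 ≤ fibPred k * harmonicFib k :=
    mul_nonneg (fibPred_nonneg k) (harmonicFib_nonneg k)
  simp only [fib_mul_harmonicFib_sub, ← mul_pow]
  constructor
  · exact Real.sqrt_le_iff.mpr ⟨Finset.sum_nonneg fun k _ => hnonneg k,
      Finset.sum_sq_le_sq_sum_of_nonneg fun k _ => hnonneg k⟩
  · apply Real.le_sqrt_of_sq_le
    simpa using sq_sum_le_card_mul_sum_sq (s := Finset.range n)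
      (f := fun k => fibPred k * harmonicFib k)
end

section
/- Let n ≥ 1 and let C_1 = Circ(𝔽_0, 𝔽_1, …, 𝔽_{n−1}) be the n×n circulant matrix with harmonic Fibonacci entries. Then ‖C_1‖_E = [ n²·𝔽_n² − n·Σ_{k=0}^{n−1} ((k+1)/F_{k+1})·(2𝔽_k + 1/F_{k+1}) ]^{1/2}. -/
open Finset

/-- The n×n circulant matrix with first row `c 0, c 1, …, c (n-1)`:
its (i,j) entry is `c ((j - i) mod n)`. -/
noncomputable def circulant (n : ℕ) (c : ℕ → ℝ) : Matrix (Fin n) (Fin n) ℝ :=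
  fun i j => c (((j : ℕ) + n - (i : ℕ)) % n)

/-- The Euclidean (Frobenius) norm of a real matrix: √(∑_{i,j} |a_{ij}|²). -/
noncomputable def frobeniusNorm (n : ℕ) (A : Matrix (Fin n) (Fin n) ℝ) : ℝ :=
  Real.sqrt (∑ i, ∑ j, |A i j| ^ 2)

/-- Summation by parts for the squares of the harmonic Fibonacci numbers. -/
theorem sum_range_harmonicFib_sq (n : ℕ) :
    ∑ k ∈ Finset.range n, harmonicFib k ^ 2 =
      (n : ℝ) * harmonicFib n ^ 2 -
        ∑ k ∈ Finset.range n, (((k : ℝ) + 1) / (Nat.fib (k + 1) : ℝ)) *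
          (2 * harmonicFib k + 1 / (Nat.fib (k + 1) : ℝ)) := by
  induction n with
  | zero => simp
  | succ n ih =>
    rw [Finset.sum_range_succ, Finset.sum_range_succ, ih, harmonicFib_succ]
    push_cast
    ring

/-- Every row of a circulant matrix is a permutation of its first row. -/
theorem sum_row_circulant (n : ℕ) (c : ℕ → ℝ) (f : ℝ → ℝ) (i : Fin n) :
    ∑ j, f (circulant n c i j) = ∑ k ∈ Finset.range n, f (c k) := by
  have : NeZero n := ⟨i.pos.ne'⟩
  rw [← Fin.sum_univ_eq_sum_range (fun k => f (c k)) n,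
    ← Equiv.sum_comp (Equiv.subRight i) (fun j : Fin n => f (c j))]
  refine Finset.sum_congr rfl fun j _ => ?_
  have h : (j : ℕ) + n - i = n - i + j := by have := i.isLt; omega
  simp only [circulant, Equiv.subRight_apply, Fin.val_sub, h]

/-- The squared Frobenius norm of a circulant matrix is `n` times that of its first row. -/
theorem sum_sum_circulant_sq (n : ℕ) (c : ℕ → ℝ) :
    ∑ i, ∑ j, |circulant n c i j| ^ 2 = (n : ℝ) * ∑ k ∈ Finset.range n, c k ^ 2 := by
  simp only [sq_abs, sum_row_circulant n c (fun x => x ^ 2), Finset.sum_const,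
    Finset.card_univ, Fintype.card_fin, nsmul_eq_mul]

theorem frobeniusNorm_circulant_harmonicFib (n : ℕ) (hn : 1 ≤ n) :
    frobeniusNorm n (circulant n harmonicFib) =
      Real.sqrt ((n : ℝ) ^ 2 * harmonicFib n ^ 2 -
        (n : ℝ) * ∑ k ∈ Finset.range n, (((k : ℝ) + 1) / (Nat.fib (k + 1) : ℝ)) *
          (2 * harmonicFib k + 1 / (Nat.fib (k + 1) : ℝ))) := by
  rw [frobeniusNorm, sum_sum_circulant_sq, sum_range_harmonicFib_sq]
  congr 1
  ring
end

section
/- For all integers n ≥ 1 and r ≥ 0, the following inequalities hold: (1/√n)·𝔽_{n−1}^{(r+1)} ≤ √(Σ_{k=0}^{n−1} (𝔽_k^{(r)})²) ≤ 𝔽_{n−1}^{(r+1)}. -/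
open Finset

/-- Hyperharmonic Fibonacci numbers: 𝔽ₙ⁽⁰⁾ = 1/Fₙ (n ≥ 1), 𝔽₀⁽ʳ⁾ = 0,
and 𝔽ₙ⁽ʳ⁾ = ∑_{j=1}^{n} 𝔽ⱼ⁽ʳ⁻¹⁾ for r ≥ 1. -/
noncomputable def hyperFib : ℕ → ℕ → ℝ
  | 0, n => if n = 0 then 0 else 1 / (Nat.fib n : ℝ)
  | r + 1, n => ∑ j ∈ Finset.range n, hyperFib r (j + 1)

theorem hyperFib_zero_right (r : ℕ) : hyperFib r 0 = 0 := by
  cases r <;> simp [hyperFib]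

theorem hyperFib_nonneg (r n : ℕ) : 0 ≤ hyperFib r n := by
  induction r generalizing n with
  | zero => rw [hyperFib]; split_ifs <;> positivity
  | succ r ih => rw [hyperFib]; exact Finset.sum_nonneg fun j _ => ih (j + 1)

theorem hyperFib_succ_eq_sum_range (r m : ℕ) :
    hyperFib (r + 1) m = ∑ k ∈ Finset.range (m + 1), hyperFib r k := by
  rw [Finset.sum_range_succ', hyperFib_zero_right, add_zero, hyperFib]

theorem hyperFib_sum_sq_bounds (n r : ℕ) (hn : 1 ≤ n) :
    (1 / Real.sqrt n) * hyperFib (r + 1) (n - 1) ≤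
        Real.sqrt (∑ k ∈ Finset.range n, hyperFib r k ^ 2) ∧
      Real.sqrt (∑ k ∈ Finset.range n, hyperFib r k ^ 2) ≤ hyperFib (r + 1) (n - 1) := by
  rw [hyperFib_succ_eq_sum_range, Nat.sub_add_cancel hn]
  have hn' : (0 : ℝ) < n := by exact_mod_cast hn
  constructor
  · have h := sq_sum_le_card_mul_sum_sq (s := Finset.range n) (f := hyperFib r)
    rw [Finset.card_range] at h
    apply Real.le_sqrt_of_sq_le
    rw [mul_pow, div_pow, one_pow, Real.sq_sqrt hn'.le, one_div, inv_mul_le_iff₀ hn']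
    exact h
  · exact Real.sqrt_le_iff.mpr ⟨Finset.sum_nonneg fun k _ => hyperFib_nonneg r k,
      Finset.sum_sq_le_sq_sum_of_nonneg fun k _ => hyperFib_nonneg r k⟩
end
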